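/- Let n ≥ 2 and K ∈ 𝒦ⁿ a convex body. Let d_K = min_{θ ∈ S^{n-1}} m_K(θ)^{1/(n-1)}, where m_K(θ) = max_{s∈ℝ} vol_{n-1}(K ∩ T_{θ,s}) is the inner section function. Then the transformed section volume CDF G_K^S, defined by G_K^S(z) = G_K(z^{n-1}), is convex on the interval (0, d_K). -/

import Mathlib

open MeasureTheory Set Pointwise
open scoped RealInnerProductSpace NNReal ENNReal

noncomputable section

abbrev Euc (n : ℕ) := EuclideanSpace ℝ (Fin n)

/-- The unit sphere `S^{n-1}` in `ℝⁿ`. -/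
def unitSphere (n : ℕ) : Set (Euc n) := {θ | ‖θ‖ = 1}

/-- The upper hemisphere `S₊^{n-1}`: unit vectors whose last coordinate is nonnegative. -/
def upperHemi (n : ℕ) : Set (Euc n) :=
  {θ | ‖θ‖ = 1 ∧ ∀ i : Fin n, (i : ℕ) = n - 1 → 0 ≤ θ i}

/-- The hyperplane `T_{θ,s} = {x : ⟨x,θ⟩ = s}`. -/
def hyperplane {n : ℕ} (θ : Euc n) (s : ℝ) : Set (Euc n) := {x | ⟪x, θ⟫ = s}

/-- Spherical Lebesgue measure, realized as the `(n-1)`-dimensional Hausdorff measure. -/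
def sphMeasure (n : ℕ) : Measure (Euc n) := μH[(n : ℝ) - 1]

/-- `vol_{n-1}(K ∩ T_{θ,s})`. -/
def sectionVolume {n : ℕ} (K : Set (Euc n)) (θ : Euc n) (s : ℝ) : ℝ :=
  (μH[(n : ℝ) - 1] (K ∩ hyperplane θ s)).toReal

/-- `μ([K])`. -/
def muBracket {n : ℕ} (K : Set (Euc n)) : ℝ :=
  ∫ θ in upperHemi n,
    (∫ s : ℝ, Set.indicator {s : ℝ | (K ∩ hyperplane θ s).Nonempty} (fun _ => (1 : ℝ)) s)
    ∂ sphMeasure n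

/-- The section volume CDF `G_K`. -/
def sectionCDF {n : ℕ} (K : Set (Euc n)) (z : ℝ) : ℝ :=
  (1 / muBracket K) *
    ∫ θ in upperHemi n,
      (∫ s : ℝ, Set.indicator
          {s : ℝ | sectionVolume K θ s ≤ z ∧ (K ∩ hyperplane θ s).Nonempty}
          (fun _ => (1 : ℝ)) s)
      ∂ sphMeasure n

/-- A convex body: a compact convex set with nonempty interior. -/
structure IsConvexBody {n : ℕ} (K : Set (Euc n)) : Prop where
  convex : Convex ℝ K
  isCompact : IsCompact K
  interiorNonempty : (interior K).Nonempty


/-- `f_θ(s) = vol_{n-1}(K ∩ T_{θ,s})^{1/(n-1)}`. -/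
def fTheta {n : ℕ} (K : Set (Euc n)) (θ : Euc n) (s : ℝ) : ℝ :=
  sectionVolume K θ s ^ ((1 : ℝ) / ((n : ℝ) - 1))

/-- The inner section function `m_K(θ) = max_s vol_{n-1}(K ∩ T_{θ,s})`. -/
def innerSection {n : ℕ} (K : Set (Euc n)) (θ : Euc n) : ℝ :=
  ⨆ s : ℝ, sectionVolume K θ s

/-- A CDF `G` is absolutely continuous w.r.t. Lebesgue measure if it admits a Lebesgue
density, i.e. `G z = ∫_{-∞}^z g(t) dt` for some nonnegative `g`. -/
def IsAbsolutelyContinuousCDF (G : ℝ → ℝ) : Prop :=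
  ∃ g : ℝ → ℝ, (∀ t, 0 ≤ g t) ∧ ∀ z : ℝ, G z = ∫ t in Set.Iic z, g t

/-- The width of `K` in direction `θ`: the length of the orthogonal projection of `K` on the
line through the origin with direction `θ`. -/
def width {n : ℕ} (K : Set (Euc n)) (θ : Euc n) : ℝ :=
  sSup ((fun x => ⟪x, θ⟫) '' K) - sInf ((fun x => ⟪x, θ⟫) '' K)

/-- The mean width `b̄(K)`. -/
def meanWidth {n : ℕ} (K : Set (Euc n)) : ℝ :=
  (1 / (sphMeasure n (upperHemi n)).toReal) * ∫ θ in upperHemi n, width K θ ∂ sphMeasure n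

/-- A strictly convex body: a convex body such that every proper convex combination of two
distinct points of `K` lies in the interior of `K`. -/
def IsStrictlyConvexBody {n : ℕ} (K : Set (Euc n)) : Prop :=
  IsConvexBody K ∧ ∀ x ∈ K, ∀ y ∈ K, x ≠ y →
    ∀ l : ℝ, l ∈ Set.Ioo (0 : ℝ) 1 → l • x + (1 - l) • y ∈ interior K

/-- A full-dimensional convex polytope: the convex hull of finitely many points, with
nonempty interior. -/
def IsFullDimPolytope {n : ℕ} (P : Set (Euc n)) : Prop :=
  (∃ V : Finset (Euc n), P = convexHull ℝ (V : Set (Euc n))) ∧ (interior P).Nonempty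


lemma bm1_compact {a b : ℝ} (ha : 0 < a) (hb : 0 < b) {A B C : Set ℝ}
    (hA : IsCompact A) (hB : IsCompact B) (nA : A.Nonempty) (nB : B.Nonempty)
    (h : ∀ x ∈ A, ∀ y ∈ B, a * x + b * y ∈ C) :
    ENNReal.ofReal a * volume A + ENNReal.ofReal b * volume B ≤ volume C := by
  obtain ⟨p, hp, hpm⟩ := hA.exists_isGreatest nA
  obtain ⟨q, hq, hqm⟩ := hB.exists_isLeast nB
  have e1 : ∀ (c d : ℝ) (_ : 0 < c) (S : Set ℝ), volume ((fun x => c * x + d) '' S)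
      = ENNReal.ofReal c * volume S := by
    intro c d hc S
    have : (fun x => c * x + d) '' S = (fun x => x + d) '' (c • S) := by
      rw [← Set.image_smul, Set.image_image]; rfl
    rw [this, Set.image_add_right, measure_preimage_add_right, Measure.addHaar_smul]
    simp [abs_of_pos hc]
  rw [← e1 a (b * q) ha A, ← e1 b (a * p) hb B, ← measure_union₀]
  · apply measure_mono
    rintro _ (⟨x, hx, rfl⟩ | ⟨y, hy, rfl⟩)
    · exact h x hx q hq
    · simp only []; rw [add_comm]; exact h p hp y hy
  · exact (hB.image (by fun_prop)).measurableSet.nullMeasurableSet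
  · refine measure_mono_null (t := {a * p + b * q}) ?_ (by simp)
    rintro _ ⟨⟨x, hx, rfl⟩, ⟨y, hy, e⟩⟩
    have h1 := hpm hx
    have h2 := hqm hy
    simp only [mem_singleton_iff] at *
    nlinarith

lemma bm1 {a b : ℝ} (ha : 0 < a) (hb : 0 < b) {A B C : Set ℝ}
    (hA : MeasurableSet A) (hB : MeasurableSet B) (nA : A.Nonempty) (nB : B.Nonempty)
    (h : ∀ x ∈ A, ∀ y ∈ B, a * x + b * y ∈ C) :
    ENNReal.ofReal a * volume A + ENNReal.ofReal b * volume B ≤ volume C := by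
  obtain ⟨x0, hx0⟩ := nA
  obtain ⟨y0, hy0⟩ := nB
  rw [hA.measure_eq_iSup_isCompact, hB.measure_eq_iSup_isCompact]
  simp only [ENNReal.mul_iSup, iSup_and']
  refine ENNReal.biSup_add_biSup_le' ⟨∅, by simp⟩ ⟨∅, by simp⟩ ?_
  rintro K ⟨hK, hK'⟩ L ⟨hL, hL'⟩
  refine le_trans ?_ (bm1_compact ha hb (hK'.insert x0) (hL'.insert y0) ⟨x0, by simp⟩
    ⟨y0, by simp⟩ (C := C) ?_)
  · gcongr <;> simp
  · intro x hx y hy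
    exact h x (insert_subset hx0 hK hx) y (insert_subset hy0 hL hy)

lemma layer {f : ℝ → ℝ≥0∞} (hf : Measurable f) (h1 : ∀ x, f x ≤ 1) :
    ∫⁻ x, f x = ∫⁻ t in Ioo (0:ℝ) 1, volume {x | ENNReal.ofReal t < f x} := by
  have := lintegral_eq_lintegral_meas_lt (volume : Measure ℝ) (f := fun x => (f x).toReal)
    (by filter_upwards with x; simp) (by fun_prop)
  have e : ∀ x, ENNReal.ofReal (f x).toReal = f x := fun x =>
    ENNReal.ofReal_toReal (ne_top_of_le_ne_top (by simp) (h1 x))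
  simp only [e] at this
  rw [this]
  have e2 : ∀ t > 0, {x | t < (f x).toReal} = {x | ENNReal.ofReal t < f x} := by
    intro t ht
    ext x
    simp only [mem_ofPred_eq]
    rw [ENNReal.ofReal_lt_iff_lt_toReal ht.le (ne_top_of_le_ne_top (by simp) (h1 x))]
  rw [setLIntegral_congr_fun (g := fun t => volume {x | ENNReal.ofReal t < f x}) measurableSet_Ioi
    (fun t ht => by simp only []; rw [e2 t ht])]
  rw [← Ioo_union_Ici_eq_Ioi (zero_lt_one (α := ℝ)), lintegral_union measurableSet_Ici
    (Set.disjoint_left.2 fun t h1 h2 => not_lt.2 h2 h1.2),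
    setLIntegral_eq_zero (s := Ici 1) measurableSet_Ici, add_zero]
  intro t (this : 1 ≤ t)
  have : {x | ENNReal.ofReal t < f x} = ∅ := by
    ext x
    simp only [mem_ofPred_eq, mem_empty_iff_false, iff_false, not_lt]
    exact (h1 x).trans (by simpa using this)
  simp [this]

lemma amgm {a b : ℝ} (ha : 0 < a) (hb : 0 < b) (hab : a + b = 1) (x y : ℝ≥0∞) :
    x ^ a * y ^ b ≤ ENNReal.ofReal a * x + ENNReal.ofReal b * y := by
  have a0 : ENNReal.ofReal a ≠ 0 := by simpa using ha
  have b0 : ENNReal.ofReal b ≠ 0 := by simpa using hb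
  rcases eq_or_ne x ∞ with rfl | hx
  · simp [ENNReal.mul_top, a0]
  rcases eq_or_ne y ∞ with rfl | hy
  · simp [ENNReal.mul_top, b0]
  lift x to ℝ≥0 using hx
  lift y to ℝ≥0 using hy
  lift a to ℝ≥0 using ha.le
  lift b to ℝ≥0 using hb.le
  rw [← ENNReal.coe_rpow_of_nonneg _ ha.le, ← ENNReal.coe_rpow_of_nonneg _ hb.le]
  simp only [ENNReal.ofReal_coe_nnreal]
  exact_mod_cast NNReal.geom_mean_le_arith_mean2_weighted a b x y (by exact_mod_cast hab)

lemma pl_norm {a b : ℝ} (ha : 0 < a) (hb : 0 < b) (hab : a + b = 1) {f g h : ℝ → ℝ≥0∞}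
    (hf : Measurable f) (hg : Measurable g) (hh : Measurable h)
    (sf : ⨆ x, f x = 1) (sg : ⨆ x, g x = 1)
    (H : ∀ x y, f x ^ a * g y ^ b ≤ h (a * x + b * y)) :
    (∫⁻ x, f x) ^ a * (∫⁻ x, g x) ^ b ≤ ∫⁻ x, h x := by
  refine (amgm ha hb hab _ _).trans ?_
  have hf1 : ∀ x, f x ≤ 1 := fun x => sf ▸ le_iSup f x
  have hg1 : ∀ x, g x ≤ 1 := fun x => sg ▸ le_iSup g x
  refine le_trans ?_ (lintegral_mono (f := fun x => min (h x) 1) (fun x => min_le_left _ _))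
  rw [layer hf hf1, layer hg hg1, layer (hh.min measurable_const) (fun x => min_le_right _ _)]
  rw [← lintegral_const_mul' _ _ (by simp), ← lintegral_const_mul' _ _ (by simp)]
  have anti : ∀ (u : ℝ → ℝ≥0∞), Antitone fun t : ℝ => volume {x | ENNReal.ofReal t < u x} := by
    intro u s t hst
    apply measure_mono
    intro x hx
    exact lt_of_le_of_lt (ENNReal.ofReal_le_ofReal hst) hx
  rw [← lintegral_add_left ((anti f).measurable.const_mul _)]
  refine setLIntegral_mono' measurableSet_Ioo fun t ht => ?_
  have ht1 : ENNReal.ofReal t < 1 := by simpa using ht.2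
  refine bm1 ha hb (measurableSet_lt measurable_const hf) (measurableSet_lt measurable_const hg)
    ?_ ?_ ?_
  · exact lt_iSup_iff.1 (sf.symm ▸ ht1)
  · exact lt_iSup_iff.1 (sg.symm ▸ ht1)
  · intro x hx y hy
    refine lt_min (lt_of_lt_of_le ?_ (H x y)) ht1
    have t0 : ENNReal.ofReal t ≠ 0 := by simpa using ht.1
    calc ENNReal.ofReal t = ENNReal.ofReal t ^ a * ENNReal.ofReal t ^ b := by
          rw [← ENNReal.rpow_add _ _ t0 (by simp), hab, ENNReal.rpow_one]
      _ < f x ^ a * g y ^ b := by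
          exact ENNReal.mul_lt_mul (ENNReal.rpow_lt_rpow hx ha) (ENNReal.rpow_lt_rpow hy hb)

lemma pl1 {a b : ℝ} (ha : 0 < a) (hb : 0 < b) (hab : a + b = 1) {f g h : ℝ → ℝ≥0∞}
    (hf : Measurable f) (hg : Measurable g) (hh : Measurable h)
    {M : ℝ≥0∞} (hM : M ≠ ∞) (sf : ∀ x, f x ≤ M) (sg : ∀ x, g x ≤ M)
    (H : ∀ x y, f x ^ a * g y ^ b ≤ h (a * x + b * y)) :
    (∫⁻ x, f x) ^ a * (∫⁻ x, g x) ^ b ≤ ∫⁻ x, h x := by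
  set F := ⨆ x, f x with hF
  set G := ⨆ x, g x with hG
  have Ft : F ≠ ∞ := ne_top_of_le_ne_top hM (iSup_le sf)
  have Gt : G ≠ ∞ := ne_top_of_le_ne_top hM (iSup_le sg)
  by_cases F0 : F = 0
  · have : ∀ x, f x = 0 := by simpa [hF] using F0
    simp [this, ha]
  by_cases G0 : G = 0
  · have : ∀ x, g x = 0 := by simpa [hG] using G0
    simp [this, hb]
  have key := pl_norm ha hb hab (f := fun x => F⁻¹ * f x) (g := fun x => G⁻¹ * g x)
    (h := fun x => (F⁻¹ ^ a * G⁻¹ ^ b) * h x) (hf.const_mul _) (hg.const_mul _) (hh.const_mul _)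
    (by rw [← ENNReal.mul_iSup, ENNReal.inv_mul_cancel F0 Ft])
    (by rw [← ENNReal.mul_iSup, ENNReal.inv_mul_cancel G0 Gt])
    (by
      intro x y
      rw [ENNReal.mul_rpow_of_nonneg _ _ ha.le, ENNReal.mul_rpow_of_nonneg _ _ hb.le,
        mul_mul_mul_comm]
      gcongr
      exact H x y)
  rw [lintegral_const_mul _ hf, lintegral_const_mul _ hg, lintegral_const_mul _ hh,
    ENNReal.mul_rpow_of_nonneg _ _ ha.le, ENNReal.mul_rpow_of_nonneg _ _ hb.le,
        mul_mul_mul_comm] at key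
  refine (ENNReal.mul_le_mul_iff_right ?_ ?_).1 key
  · exact mul_ne_zero (ENNReal.rpow_pos (by simpa using Ft) (by simpa using F0)).ne'
      (ENNReal.rpow_pos (by simpa using Gt) (by simpa using G0)).ne'
  · exact ENNReal.mul_ne_top (ENNReal.rpow_ne_top_of_nonneg ha.le (ENNReal.inv_ne_top.2 F0))
      (ENNReal.rpow_ne_top_of_nonneg hb.le (ENNReal.inv_ne_top.2 G0))

lemma pfs_symm {m : ℕ} : ⇑(MeasurableEquiv.piFinSuccAbove (fun _ : Fin (m+1) => ℝ) 0).symm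
    = fun p : ℝ × (Fin m → ℝ) => (Fin.cons p.1 p.2 : Fin (m+1) → ℝ) := by
  ext p i
  simp [MeasurableEquiv.piFinSuccAbove]

lemma vol_cons {m : ℕ} {A : Set (Fin (m+1) → ℝ)} (hA : MeasurableSet A) :
    volume A = ∫⁻ t, volume {y : Fin m → ℝ | (Fin.cons t y : Fin (m+1) → ℝ) ∈ A} := by
  have mp := (volume_preserving_piFinSuccAbove (fun _ : Fin (m+1) => ℝ) 0).symm
  rw [← mp.measure_preimage hA.nullMeasurableSet]
  rw [Measure.volume_eq_prod, Measure.prod_apply (mp.measurable hA), pfs_symm]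
  rfl

lemma meas_cons {m : ℕ} : Measurable (fun p : ℝ × (Fin m → ℝ) =>
    (Fin.cons p.1 p.2 : Fin (m+1) → ℝ)) := by
  have := (MeasurableEquiv.piFinSuccAbove (fun _ : Fin (m+1) => ℝ) 0).symm.measurable
  rwa [pfs_symm] at this

lemma bm_mult (m : ℕ) : ∀ {a b : ℝ} (_ : 0 < a) (_ : 0 < b) (_ : a + b = 1) (R : ℝ)
    {A B C : Set (Fin m → ℝ)} (_ : MeasurableSet A) (_ : MeasurableSet B) (_ : MeasurableSet C)
    (_ : ∀ x ∈ A, ∀ i, x i ∈ Icc (-R) R) (_ : ∀ x ∈ B, ∀ i, x i ∈ Icc (-R) R)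
    (_ : ∀ x ∈ A, ∀ y ∈ B, a • x + b • y ∈ C),
    volume A ^ a * volume B ^ b ≤ volume C := by
  induction m with
  | zero =>
    intro a b ha hb hab R A B C hA hB hC _ _ h
    rcases A.eq_empty_or_nonempty with rfl | ⟨x, hx⟩
    · simp [ha]
    rcases B.eq_empty_or_nonempty with rfl | ⟨y, hy⟩
    · simp [hb]
    have : ∀ S : Set (Fin 0 → ℝ), S.Nonempty → volume S = 1 := by
      intro S hS
      rw [Subsingleton.eq_univ_of_nonempty hS]
      simp [volume_pi]
    rw [this A ⟨x, hx⟩, this B ⟨y, hy⟩, this C ⟨_, h x hx y hy⟩]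
    simp
  | succ m ih =>
    intro a b ha hb hab R A B C hA hB hC bA bB h
    rw [vol_cons hA, vol_cons hB, vol_cons hC]
    have bd : ∀ S : Set (Fin (m+1) → ℝ), (∀ x ∈ S, ∀ i, x i ∈ Icc (-R) R) → ∀ t : ℝ,
      volume {y : Fin m → ℝ | (Fin.cons t y : Fin (m+1) → ℝ) ∈ S} ≤
        volume (Icc (fun _ => -R) (fun _ => R) : Set (Fin m → ℝ)) := by
      intro S hS t
      apply measure_mono
      intro y hy
      exact ⟨fun i => by simpa using (hS _ hy i.succ).1, fun i => by simpa using (hS _ hy i.succ).2⟩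
    have ms : ∀ S : Set (Fin (m+1) → ℝ), MeasurableSet S →
        Measurable fun t : ℝ => volume {y : Fin m → ℝ | (Fin.cons t y : Fin (m+1) → ℝ) ∈ S} :=
      fun S hS => measurable_measure_prodMk_left (meas_cons hS)
    have msl : ∀ S : Set (Fin (m+1) → ℝ), MeasurableSet S → ∀ t : ℝ, 
        MeasurableSet {y : Fin m → ℝ | (Fin.cons t y : Fin (m+1) → ℝ) ∈ S} :=
      fun S hS t => measurable_prodMk_left (meas_cons hS)
    refine pl1 ha hb hab (ms A hA) (ms B hB) (ms C hC) 
      (isCompact_Icc.measure_lt_top.ne) (bd A bA) (bd B bB) ?_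
    intro s t
    refine ih ha hb hab R (msl A hA s) (msl B hB t) (msl C hC _) ?_ ?_ ?_
    · intro y hy i
      simpa using bA _ hy i.succ
    · intro y hy i
      simpa using bB _ hy i.succ
    · intro x hx y hy
      have := h _ hx _ hy
      simp only [mem_ofPred_eq]
      convert this using 1
      ext i
      refine Fin.cases ?_ (fun i => ?_) i <;> simp

lemma bm_add {m : ℕ} {a b : ℝ} (ha : 0 < a) (hb : 0 < b) (R : ℝ)
    {A B C : Set (Fin m → ℝ)} (hA : MeasurableSet A) (hB : MeasurableSet B) (hC : MeasurableSet C)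
    (bA : ∀ x ∈ A, ∀ i, x i ∈ Icc (-R) R) (bB : ∀ x ∈ B, ∀ i, x i ∈ Icc (-R) R)
    (h : ∀ x ∈ A, ∀ y ∈ B, a • x + b • y ∈ C) {r q : ℝ} (hr : 0 < r) (hq : 0 < q)
    {k : ℝ≥0∞} (k0 : k ≠ 0) (kt : k ≠ ∞)
    (vA : ENNReal.ofReal (r ^ m) * k < volume A) (vB : ENNReal.ofReal (q ^ m) * k < volume B) :
    ENNReal.ofReal ((a * r + b * q) ^ m) * k < volume C := by
  set w := a * r + b * q with hw
  have w0 : 0 < w := by positivity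
  have sc : ∀ (c : ℝ) (_ : 0 < c) (S : Set (Fin m → ℝ)),
      ENNReal.ofReal (c ^ m) * k < volume S ↔ k < volume (c⁻¹ • S) := by
    intro c hc S
    rw [Measure.addHaar_smul]
    have : ENNReal.ofReal |c⁻¹ ^ Module.finrank ℝ (Fin m → ℝ)| = (ENNReal.ofReal (c ^ m))⁻¹ := by
      rw [abs_of_pos (by positivity), inv_pow, ENNReal.ofReal_inv_of_pos (by positivity)]
      simp
    rw [this, ← ENNReal.div_eq_inv_mul, ENNReal.lt_div_iff_mul_lt, mul_comm]
    · left; simpa using pow_pos hc m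
    · simp
  rw [sc _ hr] at vA
  rw [sc _ hq] at vB
  rw [sc _ w0]
  have key := bm_mult m (a := a * r / w) (b := b * q / w) (by positivity) (by positivity)
    (by field_simp; exact hw.symm) (r⁻¹ * |R| + q⁻¹ * |R|) (hA.const_smul₀ r⁻¹) (hB.const_smul₀ q⁻¹) (hC.const_smul₀ w⁻¹)
    ?_ ?_ ?_
  · refine lt_of_lt_of_le ?_ key
    calc k = k ^ (a * r / w) * k ^ (b * q / w) := by
          rw [← ENNReal.rpow_add _ _ k0 kt]
          have : a * r / w + b * q / w = 1 := by field_simp; exact hw.symm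
          rw [this, ENNReal.rpow_one]
      _ < _ := ENNReal.mul_lt_mul (ENNReal.rpow_lt_rpow vA (by positivity))
          (ENNReal.rpow_lt_rpow vB (by positivity))
  · rintro _ ⟨x, hx, rfl⟩ i
    have := abs_le.2 (show _ ∧ _ from bA x hx i)
    refine abs_le.1 ?_
    simp only [Pi.smul_apply, smul_eq_mul, abs_mul, abs_of_pos (inv_pos.2 hr)]
    have : |x i| ≤ |R| := this.trans (le_abs_self R)
    have : r⁻¹ * |x i| ≤ r⁻¹ * |R| := by gcongr
    have : 0 ≤ q⁻¹ * |R| := by positivity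
    linarith
  · rintro _ ⟨x, hx, rfl⟩ i
    have := abs_le.2 (show _ ∧ _ from bB x hx i)
    refine abs_le.1 ?_
    simp only [Pi.smul_apply, smul_eq_mul, abs_mul, abs_of_pos (inv_pos.2 hq)]
    have : |x i| ≤ |R| := this.trans (le_abs_self R)
    have : q⁻¹ * |x i| ≤ q⁻¹ * |R| := by gcongr
    have : 0 ≤ r⁻¹ * |R| := by positivity
    linarith
  · rintro _ ⟨x, hx, rfl⟩ _ ⟨y, hy, rfl⟩
    refine ⟨_, h x hx y hy, ?_⟩
    ext i
    simp
    field_simp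


lemma exists_c (m : ℕ) : ∃ c : ℝ≥0∞, c ≠ 0 ∧ c ≠ ∞ ∧ ∀ S : Set (Fin m → ℝ),
    (μH[(m:ℝ)] : Measure (Euc m)) (WithLp.ofLp ⁻¹' S) = c * volume S := by
  have H : Measure.IsAddHaarMeasure (μH[(m:ℝ)] : Measure (Euc m)) := by
    simpa using MeasureTheory.isAddHaarMeasure_hausdorffMeasure (E := EuclideanSpace ℝ (Fin m))
  let e := EuclideanSpace.equiv (Fin m) ℝ
  have H2 : Measure.IsAddHaarMeasure (Measure.map e (μH[(m:ℝ)] : Measure (Euc m))) :=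
    ContinuousLinearEquiv.isAddHaarMeasure_map e _
  refine ⟨Measure.addHaarScalarFactor (Measure.map e (μH[(m:ℝ)] : Measure (Euc m))) volume,
    ?_, by simp, fun S => ?_⟩
  · have := Measure.addHaarScalarFactor_pos_of_isAddHaarMeasure
      (Measure.map e (μH[(m:ℝ)] : Measure (Euc m))) volume
    exact_mod_cast this.ne'
  · have h1 := Measure.isAddLeftInvariant_eq_smul
      (Measure.map e (μH[(m:ℝ)] : Measure (Euc m))) (volume : Measure (Fin m → ℝ))
    have h2 : Measure.map e (μH[(m:ℝ)] : Measure (Euc m)) S = μH[(m:ℝ)] (e ⁻¹' S) :=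
      (e.toHomeomorph.toMeasurableEquiv).map_apply S
    rw [h1] at h2
    exact h2.symm

/-- reflection taking the first basis vector to `θ` -/
def refl0 {m : ℕ} (θ : Euc (m+1)) : Euc (m+1) ≃ₗᵢ[ℝ] Euc (m+1) :=
  Submodule.reflection (Submodule.span ℝ {EuclideanSpace.single 0 1 - θ})ᗮ

def PP {m : ℕ} (θ : Euc (m+1)) (s : ℝ) (y : Fin m → ℝ) : Euc (m+1) :=
  refl0 θ (WithLp.toLp 2 (Fin.cons s y : Fin (m+1) → ℝ))

lemma refl0_apply {m : ℕ} (θ x : Euc (m+1)) : refl0 θ x =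
    x - (2 * (⟪EuclideanSpace.single 0 1 - θ, x⟫ / ‖EuclideanSpace.single 0 1 - θ‖ ^ 2)) •
      (EuclideanSpace.single 0 1 - θ) := by
  unfold refl0
  rw [Submodule.reflection_orthogonal_apply, Submodule.reflection_singleton_apply]
  simp only [RCLike.ofReal_real_eq_id, id]
  module

lemma meas_PP {m : ℕ} : Measurable (fun p : (Euc (m+1) × ℝ) × (Fin m → ℝ) =>
    PP p.1.1 p.1.2 p.2) := by
  have h0 : Measurable (fun p : (Euc (m+1) × ℝ) × (Fin m → ℝ) =>
      (WithLp.toLp 2 (Fin.cons p.1.2 p.2 : Fin (m+1) → ℝ) : Euc (m+1))) := by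
    have h1 : Measurable (fun p : (Euc (m+1) × ℝ) × (Fin m → ℝ) => (p.1.2, p.2)) := by fun_prop
    exact (WithLp.measurable_toLp 2 _).comp (meas_cons.comp h1)
  have h2 : Measurable (fun p : (Euc (m+1) × ℝ) × (Fin m → ℝ) =>
      (EuclideanSpace.single 0 1 - p.1.1 : Euc (m+1))) := by fun_prop
  simp only [PP, refl0_apply]
  exact h0.sub ((((h2.inner h0).div (h2.norm.pow_const 2)).const_mul 2).smul h2)

lemma inner_refl0 {m : ℕ} {θ : Euc (m+1)} (h : ‖θ‖ = 1) (x : Euc (m+1)) :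
    ⟪refl0 θ x, θ⟫ = x 0 := by
  have h1 : refl0 θ (EuclideanSpace.single 0 1) = θ :=
    Submodule.reflection_sub (by simp [h])
  have h2 : ⟪refl0 θ x, θ⟫ = ⟪refl0 θ x, refl0 θ (EuclideanSpace.single 0 1)⟫ := by rw [h1]
  rw [h2, LinearIsometryEquiv.inner_map_map]
  simp [EuclideanSpace.inner_single_right]

lemma PP_comb {m : ℕ} (θ : Euc (m+1)) (a b s t : ℝ) (x y : Fin m → ℝ) :
    a • PP θ s x + b • PP θ t y = PP θ (a * s + b * t) (a • x + b • y) := by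
  unfold PP
  rw [← map_smul, ← map_smul, ← map_add]
  congr 1
  ext i
  refine Fin.cases ?_ (fun i => ?_) i <;> simp

lemma le_norm_PP {m : ℕ} (θ : Euc (m+1)) (s : ℝ) (y : Fin m → ℝ) (i : Fin m) :
    |y i| ≤ ‖PP θ s y‖ := by
  unfold PP
  rw [LinearIsometryEquiv.norm_map]
  simpa using PiLp.norm_apply_le (WithLp.toLp 2 (Fin.cons s y : Fin (m+1) → ℝ)) i.succ

lemma isom_PP {m : ℕ} (θ : Euc (m+1)) (s : ℝ) :
    Isometry (fun y : Euc m => PP θ s (WithLp.ofLp y)) := by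
  unfold PP
  refine (refl0 θ).isometry.comp (f := fun y : Euc m =>
    (WithLp.toLp 2 (Fin.cons s y.ofLp : Fin (m+1) → ℝ) : Euc (m+1))) ?_
  refine Isometry.of_dist_eq fun x y => ?_
  simp [EuclideanSpace.dist_eq, Fin.sum_univ_succ]

lemma section_eq {m : ℕ} {θ : Euc (m+1)} (h : ‖θ‖ = 1) (K : Set (Euc (m+1))) (s : ℝ) :
    K ∩ hyperplane θ s = (fun y : Euc m => PP θ s (WithLp.ofLp y)) ''
      (WithLp.ofLp ⁻¹' {y : Fin m → ℝ | PP θ s y ∈ K}) := by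
  ext x
  constructor
  · rintro ⟨hx, hs⟩
    have hs : ⟪x, θ⟫ = s := hs
    obtain ⟨w, rfl⟩ := (refl0 θ).surjective x
    rw [inner_refl0 h] at hs
    have e : PP θ s (Fin.tail w.ofLp) = refl0 θ w := by
      unfold PP
      rw [← hs, Fin.cons_self_tail]
    refine ⟨WithLp.toLp 2 (Fin.tail w.ofLp), ?_, e⟩
    change PP θ s (Fin.tail w.ofLp) ∈ K
    rwa [e]
  · rintro ⟨y, hy, rfl⟩
    refine ⟨hy, ?_⟩
    change ⟪_, θ⟫ = s
    simp only [PP]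
    rw [inner_refl0 h]
    simp

lemma exists_k (m : ℕ) : ∃ k : ℝ≥0∞, k ≠ 0 ∧ k ≠ ∞ ∧ ∀ (K : Set (Euc (m+1))) (_ : IsCompact K)
    (θ : Euc (m+1)) (_ : ‖θ‖ = 1) (s z : ℝ) (_ : 0 ≤ z),
    (z < sectionVolume K θ s ↔ ENNReal.ofReal z * k < volume {y : Fin m → ℝ | PP θ s y ∈ K}) := by
  obtain ⟨c, c0, ct, hc⟩ := exists_c m
  refine ⟨c⁻¹, ENNReal.inv_ne_zero.2 ct, ENNReal.inv_ne_top.2 c0, fun K hK θ hθ s z hz => ?_⟩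
  have e : (((m+1 : ℕ) : ℝ) - 1) = m := by push_cast; ring
  unfold sectionVolume
  rw [e, section_eq hθ, (isom_PP θ s).hausdorffMeasure_image (Or.inl (by positivity)), hc]
  obtain ⟨R, hR⟩ := hK.isBounded.exists_norm_le
  have fin : volume {y : Fin m → ℝ | PP θ s y ∈ K} ≠ ∞ := by
    refine ne_top_of_le_ne_top (isCompact_Icc (a := fun _ => -R) (b := fun _ => R)).measure_lt_top.ne
      (measure_mono fun y hy => ?_)
    have := fun i => abs_le.1 ((le_norm_PP θ s y i).trans (hR _ hy))
    exact ⟨fun i => (this i).1, fun i => (this i).2⟩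
  rw [← ENNReal.ofReal_lt_iff_lt_toReal hz (ENNReal.mul_ne_top ct fin),
    ← div_eq_mul_inv, ENNReal.div_lt_iff (Or.inl c0) (Or.inl ct), mul_comm]

lemma normalize_lip {E : Type*} [NormedAddCommGroup E] [NormedSpace ℝ E] :
    LipschitzOnWith 2 (fun x : E => ‖x‖⁻¹ • x) {x | 1 ≤ ‖x‖} := by
  refine LipschitzOnWith.of_dist_le_mul fun x hx y hy => ?_
  have hx : 1 ≤ ‖x‖ := hx
  have hy : 1 ≤ ‖y‖ := hy
  rw [dist_eq_norm, dist_eq_norm]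
  have x0 : 0 < ‖x‖ := by linarith
  have y0 : 0 < ‖y‖ := by linarith
  have e : ‖x‖⁻¹ • x - ‖y‖⁻¹ • y = ‖x‖⁻¹ • (x - y) + (‖x‖⁻¹ * (‖y‖ - ‖x‖)) • (‖y‖⁻¹ • y) := by
    rw [smul_smul]
    have : ‖x‖⁻¹ * (‖y‖ - ‖x‖) * ‖y‖⁻¹ = ‖x‖⁻¹ - ‖y‖⁻¹ := by field_simp
    rw [this]; module
  rw [e]
  refine (norm_add_le _ _).trans ?_
  have hn : ‖(‖y‖⁻¹ • y)‖ = 1 := by rw [norm_smul]; simp; field_simp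
  rw [norm_smul, norm_smul, hn, norm_mul]
  have h1 : ‖(‖x‖⁻¹)‖ ≤ 1 := by simpa using inv_le_one_of_one_le₀ hx
  have h2 : ‖(‖y‖ - ‖x‖)‖ ≤ ‖x - y‖ := by rw [norm_sub_rev x y]; exact abs_norm_sub_norm_le y x
  have h3 := norm_nonneg (x - y)
  have h4 := norm_nonneg (‖x‖⁻¹)
  have := mul_le_mul h1 h2 (norm_nonneg _) zero_le_one
  have := mul_le_mul_of_nonneg_right h1 h3
  push_cast
  linarith

lemma sphere_fin (m : ℕ) : (μH[(m:ℝ)] : Measure (Euc (m+1))) (unitSphere (m+1)) < ∞ := by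
  let F : Fin (m+1) → ℝ → (Fin m → ℝ) → Euc (m+1) := fun i σ y =>
    WithLp.toLp 2 (Fin.insertNth i σ y : Fin (m+1) → ℝ)
  let Q : Set (Fin m → ℝ) := Icc (fun _ => -1) (fun _ => 1)
  have cover : unitSphere (m+1) ⊆ ⋃ i : Fin (m+1), ⋃ b : Bool,
      (fun x : Euc (m+1) => ‖x‖⁻¹ • x) '' (F i (if b then 1 else -1) '' Q) := by
    intro θ hθ
    have hθ : ‖θ‖ = 1 := hθ
    obtain ⟨i, hi⟩ := Finite.exists_max (fun i => |θ i|)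
    have ti : θ i ≠ 0 := by
      intro h0
      have : θ = 0 := by
        ext j
        have := hi j
        rw [h0] at this
        simpa using this
      simp [this] at hθ
    have ti' : 0 < |θ i| := abs_pos.2 ti
    have hx : ∀ σ : ℝ, σ = |θ i|⁻¹ * θ i →
        θ ∈ (fun x : Euc (m+1) => ‖x‖⁻¹ • x) '' (F i σ '' Q) := by
      intro σ hσ
      have hF : F i σ (fun j => |θ i|⁻¹ * θ (i.succAbove j)) = |θ i|⁻¹ • θ := by
        ext j
        refine Fin.succAboveCases i ?_ (fun j => ?_) j
        · simp [F, hσ]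
        · simp [F]
      refine ⟨_, ⟨fun j => |θ i|⁻¹ * θ (i.succAbove j), ?_, rfl⟩, ?_⟩
      · have : ∀ j, -1 ≤ |θ i|⁻¹ * θ (i.succAbove j) ∧ |θ i|⁻¹ * θ (i.succAbove j) ≤ 1 := by
          intro j
          rw [← abs_le, abs_mul, abs_inv, abs_abs, inv_mul_le_iff₀ ti']
          simpa using hi (i.succAbove j)
        exact ⟨fun j => (this j).1, fun j => (this j).2⟩
      · simp only []
        rw [hF, norm_smul, hθ, smul_smul]
        simp [ti]
    simp only [mem_iUnion]
    refine ⟨i, ?_⟩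
    rcases lt_or_gt_of_ne ti with h | h
    · refine ⟨false, hx _ ?_⟩
      rw [abs_of_neg h]; simp; field_simp
    · refine ⟨true, hx _ ?_⟩
      rw [abs_of_pos h]; simp; field_simp
  refine (measure_mono cover).trans_lt ?_
  refine (measure_iUnion_le _).trans_lt ?_
  rw [tsum_fintype]
  refine ENNReal.sum_lt_top.2 fun i _ => ?_
  refine (measure_iUnion_le _).trans_lt ?_
  rw [tsum_fintype]
  refine ENNReal.sum_lt_top.2 fun b _ => ?_
  set σ : ℝ := if b then 1 else -1 with hσ
  have hG : LipschitzWith 1 (fun y : Fin m → ℝ => (Fin.insertNth i σ y : Fin (m+1) → ℝ)) := by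
    refine LipschitzWith.of_dist_le_mul fun x y => ?_
    simp only [NNReal.coe_one, one_mul]
    refine (dist_pi_le_iff dist_nonneg).2 fun j => ?_
    refine Fin.succAboveCases i ?_ (fun j => ?_) j
    · simp
    · simpa using dist_le_pi_dist x y j
  have hF : LipschitzWith _ (F i σ) :=
    (PiLp.lipschitzWith_toLp 2 (fun _ : Fin (m+1) => ℝ)).comp hG
  have hsub : F i σ '' Q ⊆ {x | 1 ≤ ‖x‖} := by
    rintro _ ⟨y, _, rfl⟩
    have := PiLp.norm_apply_le (F i σ y) i
    have h2 : ‖(F i σ y) i‖ = 1 := by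
      simp only [F, hσ]
      cases b <;> simp
    rw [h2] at this
    exact this
  refine ((normalize_lip.mono hsub).hausdorffMeasure_image_le (by positivity)).trans_lt ?_
  refine ENNReal.mul_lt_top (by simp) ?_
  refine (hF.hausdorffMeasure_image_le (by positivity) Q).trans_lt ?_
  refine ENNReal.mul_lt_top (ENNReal.rpow_lt_top_of_nonneg (by positivity) (by simp)) ?_
  have := hausdorffMeasure_pi_real (ι := Fin m)
  rw [Fintype.card_fin] at this
  rw [this]
  exact isCompact_Icc.measure_lt_top


lemma meas_W {m : ℕ} {K : Set (Euc (m+1))} (hK : IsCompact K) :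
    Measurable (fun p : Euc (m+1) × ℝ => volume {y : Fin m → ℝ | PP p.1 p.2 y ∈ K}) :=
  measurable_measure_prodMk_left (meas_PP hK.measurableSet)

lemma closed_I {n : ℕ} {K : Set (Euc n)} (hK : IsCompact K) :
    IsClosed {p : Euc n × ℝ | (K ∩ hyperplane p.1 p.2).Nonempty} := by
  have : CompactSpace K := isCompact_iff_compactSpace.1 hK
  have h1 : IsClosed {q : (Euc n × ℝ) × K | ⟪(q.2 : Euc n), q.1.1⟫ = q.1.2} :=
    isClosed_eq (by fun_prop) (by fun_prop)
  have h2 := isClosedMap_fst_of_compactSpace _ h1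
  convert h2 using 1
  ext p
  constructor
  · rintro ⟨x, hx, hs⟩
    exact ⟨(p, ⟨x, hx⟩), hs, rfl⟩
  · rintro ⟨⟨p, x⟩, hx, rfl⟩
    exact ⟨x, x.2, hx⟩

lemma S_bdd {n : ℕ} {K : Set (Euc n)} {R : ℝ} (hR : ∀ x ∈ K, ‖x‖ ≤ R) {θ : Euc n} (hθ : ‖θ‖ = 1) :
    {s : ℝ | (K ∩ hyperplane θ s).Nonempty} ⊆ Icc (-R) R := by
  rintro s ⟨x, hx, hs⟩
  have hs : ⟪x, θ⟫ = s := hs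
  have := abs_real_inner_le_norm x θ
  rw [hs, hθ, mul_one] at this
  exact abs_le.1 (this.trans (hR x hx))

lemma inner_eq {n : ℕ} {K : Set (Euc n)} {θ : Euc n} {z : ℝ}
    (h : MeasurableSet {s : ℝ | sectionVolume K θ s ≤ z ∧ (K ∩ hyperplane θ s).Nonempty}) :
    (∫ s : ℝ, Set.indicator
          {s : ℝ | sectionVolume K θ s ≤ z ∧ (K ∩ hyperplane θ s).Nonempty}
          (fun _ => (1 : ℝ)) s) =
    volume.real {s : ℝ | sectionVolume K θ s ≤ z ∧ (K ∩ hyperplane θ s).Nonempty} := by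
  have := integral_indicator_one (μ := (volume : Measure ℝ)) h
  exact this

section
variable {m : ℕ} {K : Set (Euc (m+1))}

lemma meas_S (hK : IsCompact K) {k : ℝ≥0∞} (z : ℝ) :
    MeasurableSet {p : Euc (m+1) × ℝ | ¬ (ENNReal.ofReal z * k < volume
      {y : Fin m → ℝ | PP p.1 p.2 y ∈ K}) ∧ (K ∩ hyperplane p.1 p.2).Nonempty} :=
  (measurableSet_lt measurable_const (meas_W hK)).compl.inter (closed_I hK).measurableSet

lemma meas_S1 (hK : IsCompact K) {θ : Euc (m+1)} (hθ : ‖θ‖ = 1) {z : ℝ} (hz : 0 ≤ z) :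
    MeasurableSet {s : ℝ | sectionVolume K θ s ≤ z ∧ (K ∩ hyperplane θ s).Nonempty} := by
  obtain ⟨k, k0, kt, hk⟩ := exists_k m
  simp only [← not_lt, hk K hK θ hθ _ z hz]
  exact measurable_prodMk_left (meas_S hK (k := k) z)

lemma meas_U (hK : IsCompact K) {θ : Euc (m+1)} (hθ : ‖θ‖ = 1) {z : ℝ} (hz : 0 ≤ z) :
    MeasurableSet {s : ℝ | z < sectionVolume K θ s} := by
  obtain ⟨k, k0, kt, hk⟩ := exists_k m
  simp only [hk K hK θ hθ _ z hz]
  exact measurable_prodMk_left (measurableSet_lt measurable_const (meas_W hK))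

lemma upperHemi_meas (n : ℕ) : MeasurableSet (upperHemi n) := by
  have : upperHemi n = {θ : Euc n | ‖θ‖ = 1} ∩ ⋂ i : Fin n, ⋂ _ : (i : ℕ) = n - 1, {θ | 0 ≤ θ i} := by
    ext θ
    simp [upperHemi]
  rw [this]
  refine MeasurableSet.inter ?_ ?_
  · exact (isClosed_eq continuous_norm continuous_const).measurableSet
  · refine MeasurableSet.iInter fun i => MeasurableSet.iInter fun _ => ?_
    exact (isClosed_le continuous_const (by fun_prop)).measurableSet

lemma integ (hK : IsCompact K) {z : ℝ} (hz : 0 ≤ z) :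
    IntegrableOn (fun θ => ∫ s : ℝ, Set.indicator
          {s : ℝ | sectionVolume K θ s ≤ z ∧ (K ∩ hyperplane θ s).Nonempty}
          (fun _ => (1 : ℝ)) s) (upperHemi (m+1)) (sphMeasure (m+1)) := by
  obtain ⟨k, k0, kt, hk⟩ := exists_k m
  obtain ⟨R, hR⟩ := hK.isBounded.exists_norm_le
  have fin : sphMeasure (m+1) (upperHemi (m+1)) < ∞ := by
    have e : (((m+1 : ℕ) : ℝ) - 1) = m := by push_cast; ring
    unfold sphMeasure
    rw [e]
    exact (measure_mono fun θ hθ => hθ.1).trans_lt (sphere_fin m)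
  have hg : Measurable fun θ : Euc (m+1) => volume.real {s : ℝ | ¬ (ENNReal.ofReal z * k < volume
      {y : Fin m → ℝ | PP θ s y ∈ K}) ∧ (K ∩ hyperplane θ s).Nonempty} :=
    (measurable_measure_prodMk_left (meas_S hK (k := k) z)).ennreal_toReal
  refine IntegrableOn.congr_fun (f := fun θ : Euc (m+1) =>
    volume.real {s : ℝ | ¬ (ENNReal.ofReal z * k < volume
      {y : Fin m → ℝ | PP θ s y ∈ K}) ∧ (K ∩ hyperplane θ s).Nonempty}) ?_ ?_ (upperHemi_meas _)
  · refine Measure.integrableOn_of_bounded fin.ne hg.aestronglyMeasurable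
      (M := volume.real (Icc (-R) R)) ?_
    filter_upwards [ae_restrict_mem (upperHemi_meas _)] with θ hθ
    rw [Real.norm_of_nonneg measureReal_nonneg]
    refine measureReal_mono ?_ isCompact_Icc.measure_lt_top.ne
    exact fun s hs => S_bdd hR hθ.1 hs.2
  · intro θ hθ
    simp only []
    rw [inner_eq (meas_S1 hK hθ.1 hz)]
    simp only [← not_lt, hk K hK θ hθ.1 _ z hz]

lemma brunn (hK : IsCompact K) (hc : Convex ℝ K) {θ : Euc (m+1)} (hθ : ‖θ‖ = 1) {a b r q s t : ℝ}
    (ha : 0 < a) (hb : 0 < b) (hab : a + b = 1) (hr : 0 < r) (hq : 0 < q)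
    (h1 : r ^ m < sectionVolume K θ s) (h2 : q ^ m < sectionVolume K θ t) :
    (a * r + b * q) ^ m < sectionVolume K θ (a * s + b * t) := by
  obtain ⟨k, k0, kt, hk⟩ := exists_k m
  obtain ⟨R, hR⟩ := hK.isBounded.exists_norm_le
  rw [hk K hK θ hθ _ _ (by positivity)] at h1 h2 ⊢
  have ms : ∀ s, MeasurableSet {y : Fin m → ℝ | PP θ s y ∈ K} := fun s =>
    measurable_prodMk_left (x := (θ, s)) (meas_PP hK.measurableSet)
  have bd : ∀ s, ∀ y ∈ {y : Fin m → ℝ | PP θ s y ∈ K}, ∀ i, y i ∈ Icc (-R) R :=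
    fun s y hy i => abs_le.1 ((le_norm_PP θ s y i).trans (hR _ hy))
  refine bm_add ha hb R (ms _) (ms _) (ms _) (bd _) (bd _) ?_ hr hq k0 kt h1 h2
  intro x hx y hy
  have := hc hx hy ha.le hb.le hab
  rw [PP_comb] at this
  exact this

lemma conv_theta (hK : IsCompact K) (hc : Convex ℝ K) {θ : Euc (m+1)} (hθ : ‖θ‖ = 1)
    {a b r q : ℝ}
    (ha : 0 < a) (hb : 0 < b) (hab : a + b = 1) (hr : 0 < r) (hq : 0 < q)
    (h1 : ∃ s, r ^ m < sectionVolume K θ s) (h2 : ∃ s, q ^ m < sectionVolume K θ s) :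
    volume.real {s : ℝ | sectionVolume K θ s ≤ (a * r + b * q) ^ m ∧
      (K ∩ hyperplane θ s).Nonempty} ≤
    a * volume.real {s : ℝ | sectionVolume K θ s ≤ r ^ m ∧ (K ∩ hyperplane θ s).Nonempty} +
    b * volume.real {s : ℝ | sectionVolume K θ s ≤ q ^ m ∧ (K ∩ hyperplane θ s).Nonempty} := by
  obtain ⟨R, hR⟩ := hK.isBounded.exists_norm_le
  set I := {s : ℝ | (K ∩ hyperplane θ s).Nonempty} with hI
  have If : volume I ≠ ∞ :=
    ne_top_of_le_ne_top isCompact_Icc.measure_lt_top.ne (measure_mono (S_bdd hR hθ))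
  have sub : ∀ z : ℝ, 0 ≤ z → {s : ℝ | z < sectionVolume K θ s} ⊆ I := by
    intro z hz s hs
    by_contra hne
    have hne : K ∩ hyperplane θ s = ∅ := Set.not_nonempty_iff_eq_empty.1 hne
    have hs : z < sectionVolume K θ s := hs
    simp only [sectionVolume, hne, measure_empty, ENNReal.toReal_zero] at hs
    linarith
  have Uf : ∀ z : ℝ, 0 ≤ z → volume {s : ℝ | z < sectionVolume K θ s} ≠ ∞ := fun z hz =>
    ne_top_of_le_ne_top If (measure_mono (sub z hz))
  have eS : ∀ z : ℝ, 0 ≤ z → volume.real {s : ℝ | sectionVolume K θ s ≤ z ∧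
      (K ∩ hyperplane θ s).Nonempty} = volume.real I -
        volume.real {s : ℝ | z < sectionVolume K θ s} := by
    intro z hz
    rw [← measureReal_sdiff (sub z hz) (meas_U hK hθ hz) If]
    congr 1
    ext s
    simp [hI, and_comm]
  have r0 : 0 ≤ r ^ m := by positivity
  have q0 : 0 ≤ q ^ m := by positivity
  have w0 : 0 ≤ (a * r + b * q) ^ m := by positivity
  rw [eS _ r0, eS _ q0, eS _ w0]
  have key := bm1 ha hb (meas_U hK hθ r0) (meas_U hK hθ q0) h1 h2
    (C := {s : ℝ | (a * r + b * q) ^ m < sectionVolume K θ s})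
    (fun s hs t ht => brunn hK hc hθ ha hb hab hr hq hs ht)
  have key2 := ENNReal.toReal_mono (Uf _ w0) key
  rw [ENNReal.toReal_add (ENNReal.mul_ne_top (by simp) (Uf _ r0))
    (ENNReal.mul_ne_top (by simp) (Uf _ q0)), ENNReal.toReal_mul, ENNReal.toReal_mul,
    ENNReal.toReal_ofReal ha.le, ENNReal.toReal_ofReal hb.le] at key2
  simp only [Measure.real] at *
  have : b = 1 - a := by linarith
  subst this
  linarith

end

/-- the transformed section volume CDF `G_K^S(z) = G_K(z^{n-1})` is convex
on the interval `(0, d_K)`, where `d_K = min_{θ ∈ S^{n-1}} m_K(θ)^{1/(n-1)}`. -/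
theorem transformed_sectionCDF_convexOn {n : ℕ} (hn : 2 ≤ n)
    (K : Set (Euc n)) (hK : IsConvexBody K) (dK : ℝ)
    (hdK : IsLeast ((fun θ : Euc n => innerSection K θ ^ ((1 : ℝ) / ((n : ℝ) - 1))) ''
      unitSphere n) dK) :
    ConvexOn ℝ (Set.Ioo (0 : ℝ) dK) (fun z => sectionCDF K (z ^ (n - 1))) := by
  obtain ⟨m, rfl⟩ : ∃ m, n = m + 1 := ⟨n - 1, by omega⟩
  have m0 : m ≠ 0 := by omega
  have e : (((m+1 : ℕ) : ℝ) - 1) = m := by push_cast; ring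
  rw [e] at hdK
  have ex : ∀ z ∈ Ioo 0 dK, ∀ θ : Euc (m+1), ‖θ‖ = 1 → ∃ s, z ^ m < sectionVolume K θ s := by
    intro z hz θ hθ
    have h1 : dK ≤ innerSection K θ ^ ((1:ℝ) / m) := hdK.2 ⟨θ, hθ, rfl⟩
    have i0 : 0 ≤ innerSection K θ := Real.iSup_nonneg fun s => ENNReal.toReal_nonneg
    have h2 : z ^ m < innerSection K θ := by
      have h3 : z ^ m < (innerSection K θ ^ ((1:ℝ) / m)) ^ m :=
        pow_lt_pow_left₀ (hz.2.trans_le h1) hz.1.le m0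
      rwa [one_div, Real.rpow_inv_natCast_pow i0 m0] at h3
    exact exists_lt_of_lt_ciSup h2
  rw [convexOn_iff_forall_pos]
  refine ⟨convex_Ioo _ _, fun r hr q hq a b ha hb hab => ?_⟩
  simp only [Nat.add_sub_cancel, smul_eq_mul]
  have r0 : 0 ≤ r ^ m := pow_nonneg hr.1.le m
  have q0 : 0 ≤ q ^ m := pow_nonneg hq.1.le m
  have w0 : 0 ≤ (a * r + b * q) ^ m :=
    pow_nonneg (add_nonneg (mul_nonneg ha.le hr.1.le) (mul_nonneg hb.le hq.1.le)) m
  have mu0 : 0 ≤ 1 / muBracket K := by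
    refine one_div_nonneg.2 (integral_nonneg fun θ => integral_nonneg fun s => ?_)
    exact Set.indicator_nonneg (fun _ _ => zero_le_one) s
  have hKc := hK.isCompact
  unfold sectionCDF
  rw [mul_left_comm a, mul_left_comm b, ← mul_add]
  refine mul_le_mul_of_nonneg_left ?_ mu0
  rw [← integral_const_mul, ← integral_const_mul,
    ← integral_add ((integ hKc r0).const_mul a) ((integ hKc q0).const_mul b)]
  refine setIntegral_mono_on (integ hKc w0)
    (((integ hKc r0).const_mul a).add ((integ hKc q0).const_mul b)) (upperHemi_meas _) ?_
  intro θ hθ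
  rw [inner_eq (meas_S1 hKc hθ.1 r0), inner_eq (meas_S1 hKc hθ.1 q0),
    inner_eq (meas_S1 hKc hθ.1 w0)]
  exact conv_theta hKc hK.convex hθ.1 ha hb hab hr.1 hq.1 (ex r hr θ hθ.1) (ex q hq θ hθ.1)
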